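/- Let N ≥ 3, p > 1 and σ ≤ (N+1−(N−1)p)/2. Let ℝ^N₊ = {x ∈ ℝ^N : x_N > 0} be the open upper half-space. Then there is no function u : ℝ^N → ℝ that is continuous on the closed half-space {x_N ≥ 0}, vanishes on the hyperplane {x_N = 0}, is twice continuously differentiable and positive on ℝ^N₊, and satisfies −Δu(x) + σ·‖∇u(x)‖²/u(x) ≥ u(x)^p for every x ∈ ℝ^N₊. -/

import Mathlib

open MeasureTheory Filter Set

/-- The Euclidean Laplacian: the sum of the second partial derivatives. -/
noncomputable def lap {N : ℕ} (u : EuclideanSpace ℝ (Fin N) → ℝ)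
    (x : EuclideanSpace ℝ (Fin N)) : ℝ :=
  ∑ i : Fin N,
    fderiv ℝ (fun y => fderiv ℝ u y (EuclideanSpace.single i 1)) x (EuclideanSpace.single i 1)

theorem norm_gradient_sq_eq_sum {N : ℕ} (u : EuclideanSpace ℝ (Fin N) → ℝ)
    (x : EuclideanSpace ℝ (Fin N)) :
    ‖gradient u x‖ ^ 2 = ∑ i, fderiv ℝ u x (EuclideanSpace.single i 1) ^ 2 := by
  rw [EuclideanSpace.real_norm_sq_eq]
  refine Finset.sum_congr rfl fun i _ => ?_
  congr 1
  have h : inner ℝ (gradient u x) (EuclideanSpace.single i (1 : ℝ)) =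
      fderiv ℝ u x (EuclideanSpace.single i 1) := by
    simp [gradient]
  rw [← h, EuclideanSpace.inner_single_right]
  simp

theorem lap_rpow {N : ℕ} {u : EuclideanSpace ℝ (Fin N) → ℝ} {U : Set (EuclideanSpace ℝ (Fin N))}
    (hU : IsOpen U) (hu : ContDiffOn ℝ 2 u U) (hpos : ∀ x ∈ U, 0 < u x) (s : ℝ)
    {x : EuclideanSpace ℝ (Fin N)} (hx : x ∈ U) :
    lap (fun y => u y ^ s) x =
      s * u x ^ (s - 1) * (lap u x + (s - 1) * ‖gradient u x‖ ^ 2 / u x) := by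
  have hd : ∀ y ∈ U, DifferentiableAt ℝ u y := fun y hy =>
    (hu.contDiffAt (hU.mem_nhds hy)).differentiableAt (by norm_num)
  have hfd : ∀ i, ∀ y ∈ U, fderiv ℝ (fun z => u z ^ s) y (EuclideanSpace.single i 1) =
      s * u y ^ (s - 1) * fderiv ℝ u y (EuclideanSpace.single i 1) := by
    intro i y hy
    rw [((hd y hy).hasFDerivAt.rpow_const (p := s) (Or.inl (hpos y hy).ne')).fderiv]
    simp
  have hd2 : DifferentiableAt ℝ (fderiv ℝ u) x :=
    ((hu.contDiffAt (hU.mem_nhds hx)).fderiv_right (m := 1) (by norm_num)).differentiableAt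
      (by norm_num)
  have hu0 := hpos x hx
  rw [norm_gradient_sq_eq_sum]
  simp only [lap]
  rw [Finset.mul_sum, Finset.sum_div, ← Finset.sum_add_distrib, Finset.mul_sum]
  refine Finset.sum_congr rfl fun i _ => ?_
  have he : (fun y => fderiv ℝ (fun z => u z ^ s) y (EuclideanSpace.single i 1)) =ᶠ[nhds x]
      fun y => s * u y ^ (s - 1) * fderiv ℝ u y (EuclideanSpace.single i 1) := by
    filter_upwards [hU.mem_nhds hx] with y hy using hfd i y hy
  rw [he.fderiv_eq]
  have h1 := ((hd x hx).hasFDerivAt.rpow_const (p := s - 1) (Or.inl hu0.ne')).const_mul s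
  have h2 : DifferentiableAt ℝ (fun y => fderiv ℝ u y (EuclideanSpace.single i 1)) x := by
    fun_prop
  rw [(h1.fun_mul h2.hasFDerivAt).fderiv]
  have h3 : u x ^ (s - 1 - 1) = u x ^ (s - 1) / u x := by
    rw [Real.rpow_sub_one hu0.ne' (s - 1)]
  simp only [h3, _root_.add_apply, _root_.smul_apply, smul_eq_mul]
  field_simp

theorem lap_comp_add_right {N : ℕ} (u : EuclideanSpace ℝ (Fin N) → ℝ)
    (a x : EuclideanSpace ℝ (Fin N)) : lap (fun y => u (y + a)) x = lap u (x + a) := by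
  simp only [lap]
  refine Finset.sum_congr rfl fun i _ => ?_
  have : (fun y => fderiv ℝ (fun z => u (z + a)) y (EuclideanSpace.single i 1)) =
      fun y => (fun z => fderiv ℝ u z (EuclideanSpace.single i 1)) (y + a) := by
    ext y
    rw [fderiv_comp_add_right]
  rw [this, fderiv_comp_add_right (f := fun z => fderiv ℝ u z (EuclideanSpace.single i 1))]

theorem hasDerivAt_comp_max_zero {g g' : ℝ → ℝ} (hg : ∀ s, 0 ≤ s → HasDerivAt g (g' s) s)
    (h0' : g' 0 = 0) (s : ℝ) :
    HasDerivAt (fun t => g (max t 0)) (g' (max s 0)) s := by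
  rcases lt_trichotomy s 0 with hs | rfl | hs
  · rw [max_eq_right hs.le, h0']
    refine (hasDerivAt_const s (g 0)).congr_of_eventuallyEq ?_
    filter_upwards [Iio_mem_nhds hs] with t ht
    rw [max_eq_right (le_of_lt ht)]
  · rw [max_self, h0', ← hasDerivWithinAt_univ, ← Iic_union_Ici (a := (0 : ℝ))]
    refine HasDerivWithinAt.union ?_ ?_
    · refine (hasDerivWithinAt_const (0 : ℝ) (Iic 0) (g 0)).congr_of_mem (fun t ht => ?_) (by simp)
      rw [max_eq_right ht]
    · refine HasDerivWithinAt.congr_of_mem (f := g) ?_ (fun t ht => ?_) (by simp)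
      · simpa only [h0'] using (hg 0 le_rfl).hasDerivWithinAt (s := Ici 0)
      · rw [max_eq_left ht]
  · rw [max_eq_left hs.le]
    refine (hg s hs.le).congr_of_eventuallyEq ?_
    filter_upwards [Ioi_mem_nhds hs] with t ht
    rw [max_eq_left (le_of_lt ht)]

theorem contDiff_two_of_hasDerivAt {f f' f'' : ℝ → ℝ} (hf : ∀ s, HasDerivAt f (f' s) s)
    (hf' : ∀ s, HasDerivAt f' (f'' s) s) (hc : Continuous f'') : ContDiff ℝ 2 f := by
  rw [show (2 : WithTop ℕ∞) = 1 + 1 by norm_num, contDiff_succ_iff_deriv]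
  refine ⟨fun s => (hf s).differentiableAt, by simp, ?_⟩
  rw [show deriv f = f' from funext fun s => (hf s).deriv, contDiff_one_iff_deriv]
  refine ⟨fun s => (hf' s).differentiableAt, ?_⟩
  rwa [show deriv f' = f'' from funext fun s => (hf' s).deriv]

/-- There is a convex `C²` function on the line that vanishes on the negative half-line, is positive
on the positive one, grows at most linearly and satisfies `s h'(s) ≤ 3 h(s)`. -/
theorem exists_convex_weight : ∃ h : ℝ → ℝ, ContDiff ℝ 2 h ∧ (∀ s ≤ 0, h s = 0) ∧
    (∀ s, 0 < s → 0 < h s) ∧ (∀ s, h s ≤ |s|) ∧ (∀ s, 0 ≤ deriv (deriv h) s) ∧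
    (∀ s, 0 ≤ s * deriv h s) ∧ (∀ s, s * deriv h s ≤ 3 * h s) := by
  have d0 : ∀ s : ℝ, HasDerivAt (fun t : ℝ => (max t 0) ^ 3 / (1 + max t 0) ^ 2)
      ((max s 0) ^ 2 * (max s 0 + 3) / (1 + max s 0) ^ 3) s := by
    refine hasDerivAt_comp_max_zero (g := fun t => t ^ 3 / (1 + t) ^ 2)
      (g' := fun t => t ^ 2 * (t + 3) / (1 + t) ^ 3) (fun s hs => ?_) (by simp)
    have h1 : (1 + s) ≠ 0 := by positivity
    have := (hasDerivAt_pow 3 s).div (((hasDerivAt_id s).const_add 1).pow 2) (pow_ne_zero 2 h1)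
    refine this.congr_deriv ?_
    simp
    field_simp
    ring
  have d1 : ∀ s : ℝ, HasDerivAt (fun s : ℝ => (max s 0) ^ 2 * (max s 0 + 3) / (1 + max s 0) ^ 3)
      (6 * (max s 0) / (1 + max s 0) ^ 4) s := by
    refine hasDerivAt_comp_max_zero (g := fun t => t ^ 2 * (t + 3) / (1 + t) ^ 3)
      (g' := fun t => 6 * t / (1 + t) ^ 4) (fun s hs => ?_) (by simp)
    have h1 : (1 + s) ≠ 0 := by positivity
    have := ((hasDerivAt_pow 2 s).mul ((hasDerivAt_id s).add_const 3)).div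
      (((hasDerivAt_id s).const_add 1).pow 3) (pow_ne_zero 3 h1)
    refine this.congr_deriv ?_
    simp
    field_simp
    ring
  have hne : ∀ s : ℝ, 0 < 1 + max s 0 := fun s => by positivity
  have e0 := fun s => (d0 s).deriv
  have e1 : deriv (fun t : ℝ => (max t 0) ^ 3 / (1 + max t 0) ^ 2) = _ := funext e0
  refine ⟨_, contDiff_two_of_hasDerivAt d0 d1 ?_, ?_, ?_, ?_, ?_, ?_, ?_⟩
  · exact Continuous.div (by fun_prop) (by fun_prop) fun s => (pow_pos (hne s) 4).ne'
  · intro s hs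
    simp [max_eq_right hs]
  · intro s hs
    simp only [max_eq_left hs.le]
    positivity
  · intro s
    have h1 : max s 0 ≤ |s| := max_le (le_abs_self s) (abs_nonneg s)
    refine le_trans ?_ h1
    rw [div_le_iff₀ (pow_pos (hne s) 2)]
    have := le_max_right s 0
    nlinarith [pow_nonneg this 2]
  · intro s
    rw [e1, (d1 s).deriv]
    positivity
  · intro s
    rw [e0]
    rcases le_total s 0 with hs | hs
    · simp [max_eq_right hs]
    · positivity
  · intro s
    rw [e0]
    rcases le_total s 0 with hs | hs
    · simp [max_eq_right hs]
    · rw [max_eq_left hs, mul_div_assoc', mul_div_assoc', div_le_div_iff₀ (by positivity)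
        (by positivity)]
      have : 0 ≤ s ^ 3 * (1 + s) ^ 2 * (2 * s) := by positivity
      nlinarith

/-- There is a `C²` cutoff on the line whose first two derivatives are controlled by its
`1/q`-th power. -/
theorem exists_cutoff {q : ℝ} (hq : 1 < q) : ∃ η : ℝ → ℝ, ∃ C : ℝ, ContDiff ℝ 2 η ∧ 0 ≤ C ∧
    (∀ t, 0 ≤ η t) ∧ (∀ t, η t ≤ 1) ∧ (∀ t ≤ 1, η t = 1) ∧ (∀ t, 2 ≤ t → η t = 0) ∧
    (∀ t, |deriv η t| ≤ C * η t ^ (1 / q)) ∧ (∀ t, |deriv (deriv η) t| ≤ C * η t ^ (1 / q)) := by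
  set θ : ℝ → ℝ := fun t => Real.smoothTransition (2 - t) with hθ
  have hθc : ContDiff ℝ 2 θ := (Real.smoothTransition.contDiff (n := 2)).comp (by fun_prop)
  have hθ' : ContDiff ℝ 1 (deriv θ) := hθc.deriv'
  have hθ0 : ∀ t, 0 ≤ θ t := fun t => Real.smoothTransition.nonneg _
  have hθ1 : ∀ t, θ t ≤ 1 := fun t => Real.smoothTransition.le_one _
  have hl : ∀ t ≤ 1, θ t = 1 := fun t ht => Real.smoothTransition.one_of_one_le (by linarith)
  have hr : ∀ t, 2 ≤ t → θ t = 0 := fun t ht => Real.smoothTransition.zero_of_nonpos (by linarith)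
  have hloc : ∀ t ∉ Icc (1 : ℝ) 2, ∃ c : ℝ, θ =ᶠ[nhds t] fun _ => c := by
    intro t ht
    rcases lt_or_ge t 1 with h | h
    · refine ⟨1, ?_⟩
      filter_upwards [Iio_mem_nhds h] with s hs using hl s (le_of_lt hs)
    · have h2 : 2 < t := by
        by_contra! h2
        exact ht ⟨h, h2⟩
      refine ⟨0, ?_⟩
      filter_upwards [Ioi_mem_nhds h2] with s hs using hr s (le_of_lt hs)
  have hb : ∀ f : ℝ → ℝ, Continuous f → (∀ t ∉ Icc (1 : ℝ) 2, f t = 0) →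
      ∃ B, 0 ≤ B ∧ ∀ t, |f t| ≤ B := by
    intro f hf h0
    obtain ⟨B, hB⟩ := (isCompact_Icc (a := (1 : ℝ)) (b := 2)).exists_bound_of_continuousOn
      hf.continuousOn
    refine ⟨max B 0, le_max_right _ _, fun t => ?_⟩
    by_cases ht : t ∈ Icc (1 : ℝ) 2
    · exact (hB t ht).trans (le_max_left _ _)
    · simp [h0 t ht]
  obtain ⟨B, hB0, hB⟩ := hb (deriv θ) hθ'.continuous fun t ht => by
    obtain ⟨c, hc⟩ := hloc t ht
    simp [hc.deriv_eq]
  obtain ⟨D, hD0, hD⟩ := hb (deriv (deriv θ)) (hθ'.continuous_deriv le_rfl) fun t ht => by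
    obtain ⟨c, hc⟩ := hloc t ht
    simp [hc.deriv.deriv_eq]
  obtain ⟨k, hk⟩ := exists_nat_gt (2 * q / (q - 1))
  have hk2 : 2 * q < k * (q - 1) := by rwa [div_lt_iff₀ (by linarith)] at hk
  have hkq : (k : ℝ) / q ≤ (k : ℝ) - 2 := by
    rw [div_le_iff₀ (by linarith)]
    linarith
  have hk3 : 2 < k := by
    have : (2 : ℝ) < k := by nlinarith
    exact_mod_cast this
  obtain ⟨n, rfl⟩ : ∃ n, k = n + 2 := ⟨k - 2, by omega⟩
  have hpow : ∀ t, θ t ^ n ≤ (θ t ^ (n + 2)) ^ (1 / q) := by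
    intro t
    rw [← Real.rpow_natCast, ← Real.rpow_natCast, ← Real.rpow_mul (hθ0 t)]
    refine Real.rpow_le_rpow_of_exponent_ge' (hθ0 t) (hθ1 t) (by positivity) ?_
    push_cast at hkq ⊢
    rw [mul_one_div]
    linarith
  have hd : ∀ t, HasDerivAt θ (deriv θ t) t := fun t =>
    (hθc.differentiable (by norm_num) t).hasDerivAt
  have hd' : ∀ t, HasDerivAt (deriv θ) (deriv (deriv θ) t) t := fun t =>
    (hθ'.differentiable (by norm_num) t).hasDerivAt
  have e1 : deriv (fun t => θ t ^ (n + 2)) = fun t => ((n + 2 : ℕ) : ℝ) * θ t ^ (n + 1) * deriv θ t :=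
    funext fun t => ((hd t).pow (n + 2)).deriv
  have e2 : ∀ t, deriv (deriv (fun t => θ t ^ (n + 2))) t = ((n + 2 : ℕ) : ℝ) *
      (((n + 1 : ℕ) : ℝ) * θ t ^ n * deriv θ t) * deriv θ t +
      ((n + 2 : ℕ) : ℝ) * θ t ^ (n + 1) * deriv (deriv θ) t := by
    intro t
    rw [e1]
    exact ((((hd t).pow (n + 1)).const_mul ((n + 2 : ℕ) : ℝ)).mul (hd' t)).deriv
  have hs : ∀ t, θ t ^ (n + 1) ≤ θ t ^ n := fun t =>
    pow_le_pow_of_le_one (hθ0 t) (hθ1 t) (by omega)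
  set a : ℝ := ((n + 2 : ℕ) : ℝ)
  set b : ℝ := ((n + 1 : ℕ) : ℝ)
  have ha : 0 ≤ a := by positivity
  have hb' : 0 ≤ b := by positivity
  refine ⟨fun t => θ t ^ (n + 2), a * B + a * b * B * B + a * D, hθc.pow _, by positivity,
    fun t => pow_nonneg (hθ0 t) _, fun t => pow_le_one₀ (hθ0 t) (hθ1 t), fun t ht => by simp [hl t ht],
    fun t ht => by simp [hr t ht], fun t => ?_, fun t => ?_⟩
  · refine le_trans ?_ (mul_le_mul_of_nonneg_left (hpow t) (by positivity))
    have h0 := pow_nonneg (hθ0 t) n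
    have h1 := pow_nonneg (hθ0 t) (n + 1)
    rw [e1, abs_mul, abs_mul, abs_of_nonneg ha, abs_of_nonneg h1]
    calc a * θ t ^ (n + 1) * |deriv θ t| ≤ a * θ t ^ n * B := by
          gcongr ?_ * ?_
          exacts [mul_le_mul_of_nonneg_left (hs t) ha, hB t]
      _ = a * B * θ t ^ n := by ring
      _ ≤ _ := by
          gcongr
          nlinarith [show 0 ≤ a * b * B * B by positivity, show 0 ≤ a * D by positivity]
  · refine le_trans ?_ (mul_le_mul_of_nonneg_left (hpow t) (by positivity))
    have h0 := pow_nonneg (hθ0 t) n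
    have h1 := pow_nonneg (hθ0 t) (n + 1)
    rw [e2]
    refine (abs_add_le _ _).trans ?_
    simp only [abs_mul, abs_of_nonneg ha, abs_of_nonneg hb', abs_of_nonneg h1, abs_of_nonneg h0]
    calc a * (b * θ t ^ n * |deriv θ t|) * |deriv θ t| + a * θ t ^ (n + 1) * |deriv (deriv θ) t|
        ≤ a * (b * θ t ^ n * B) * B + a * θ t ^ n * D := by
          gcongr a * (b * _ * ?_) * ?_ + ?_ * ?_
          exacts [hB t, hB t, mul_le_mul_of_nonneg_left (hs t) ha, hD t]
      _ = (a * b * B * B + a * D) * θ t ^ n := by ring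
      _ ≤ _ := by
          gcongr
          nlinarith [show 0 ≤ a * B by positivity]

theorem le_add_rpow_of_holderConjugate {q q' : ℝ} (h : q.HolderConjugate q') {a b t : ℝ}
    (ha : 0 ≤ a) (hb : 0 ≤ b) (ht : 0 < t) :
    a * b ≤ t ^ q * a ^ q + t⁻¹ ^ q' * b ^ q' := by
  have h1 := Real.young_inequality_of_nonneg (mul_nonneg ht.le ha)
    (mul_nonneg (inv_nonneg.2 ht.le) hb) h
  rw [Real.mul_rpow ht.le ha, Real.mul_rpow (inv_nonneg.2 ht.le) hb] at h1
  have h2 : t * a * (t⁻¹ * b) = a * b := by field_simp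
  rw [h2] at h1
  refine h1.trans (add_le_add ?_ ?_)
  · exact div_le_self (by positivity) h.lt.le
  · exact div_le_self (by positivity) h.symm.lt.le

theorem nonpos_of_doubling {J : ℝ → ℝ} (hJ : Monotone J) {M : ℝ} (hM : ∀ R, 1 ≤ R → J R ≤ M)
    (hd : ∀ δ, 0 < δ → ∃ K, ∀ R, 1 ≤ R → J R ≤ K * (J (2 * R) - J R) + δ) : J 1 ≤ 0 := by
  have hlim : Tendsto J atTop (nhds (⨆ R, J R)) := by
    refine tendsto_atTop_ciSup hJ ⟨M, ?_⟩
    rintro _ ⟨R, rfl⟩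
    exact (hJ (le_max_left R 1)).trans (hM _ (le_max_right R 1))
  have h2 : Tendsto (fun R => J (2 * R)) atTop (nhds (⨆ R, J R)) :=
    hlim.comp (tendsto_id.const_mul_atTop (by norm_num))
  refine le_of_forall_pos_le_add fun δ hδ => ?_
  obtain ⟨K, hK⟩ := hd δ hδ
  have h3 : Tendsto (fun R => K * (J (2 * R) - J R) + δ) atTop (nhds (0 + δ)) := by
    simpa using ((h2.sub hlim).const_mul K).add_const δ
  refine ge_of_tendsto h3 ?_
  filter_upwards [eventually_ge_atTop 1] with R hR
  exact (hJ hR).trans (hK R hR)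

theorem continuous_mul_of_tsupport_subset {X : Type*} [TopologicalSpace X] {U : Set X}
    (hU : IsOpen U) {f g : X → ℝ} (hf : Continuous f) (hfU : tsupport f ⊆ U)
    (hg : ContinuousOn g U) : Continuous fun x => f x * g x :=
  continuous_of_tsupport fun _ hx => hf.continuousAt.mul <|
    hg.continuousAt <| hU.mem_nhds <| hfU <| tsupport_mul_subset_left hx

theorem ContDiffOn.contDiffOn_fderiv_apply {N : ℕ} {U : Set (EuclideanSpace ℝ (Fin N))}
    (hU : IsOpen U) {w : EuclideanSpace ℝ (Fin N) → ℝ} {n k : WithTop ℕ∞}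
    (hw : ContDiffOn ℝ n w U) (hk : k + 1 ≤ n) (e : EuclideanSpace ℝ (Fin N)) :
    ContDiffOn ℝ k (fun y => fderiv ℝ w y e) U :=
  (hw.fderiv_of_isOpen hU hk).clm_apply contDiffOn_const

/-- Green's identity for a compactly supported test function. -/
theorem integral_mul_lap_eq {N : ℕ} {U : Set (EuclideanSpace ℝ (Fin N))} (hU : IsOpen U)
    {w ψ : EuclideanSpace ℝ (Fin N) → ℝ} (hw : ContDiffOn ℝ 2 w U) (hψ : ContDiff ℝ 2 ψ)
    (hc : HasCompactSupport ψ) (hs : tsupport ψ ⊆ U) :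
    Integrable (fun x => ψ x * lap w x) ∧ Integrable (fun x => lap ψ x * w x) ∧
      ∫ x, ψ x * lap w x = ∫ x, lap ψ x * w x := by
  have hint : ∀ f g : EuclideanSpace ℝ (Fin N) → ℝ, Continuous f → tsupport f ⊆ tsupport ψ →
      ContinuousOn g U → Integrable (fun x => f x * g x) := by
    intro f g hf hfs hg
    refine (continuous_mul_of_tsupport_subset hU hf (hfs.trans hs) hg).integrable_of_hasCompactSupport
      ?_
    have hcf : HasCompactSupport f := hc.of_isClosed_subset (isClosed_tsupport f) hfs
    exact hcf.mul_right
  have hψ1 : ∀ i, ContDiff ℝ 1 (fun y => fderiv ℝ ψ y (EuclideanSpace.single i 1)) := fun i =>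
    contDiffOn_univ.1 (hψ.contDiffOn.contDiffOn_fderiv_apply isOpen_univ (by norm_num) _)
  have hψ2 : ∀ i, Continuous (fun x => fderiv ℝ (fun y => fderiv ℝ ψ y
      (EuclideanSpace.single i 1)) x (EuclideanSpace.single i 1)) := fun i =>
    (contDiffOn_univ.1 ((hψ1 i).contDiffOn.contDiffOn_fderiv_apply isOpen_univ (k := 0)
      (by norm_num) _)).continuous
  have hw1 : ∀ i, ContDiffOn ℝ 1 (fun y => fderiv ℝ w y (EuclideanSpace.single i 1)) U := fun i =>
    hw.contDiffOn_fderiv_apply hU (by norm_num) _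
  have hw2 : ∀ i, ContinuousOn (fun x => fderiv ℝ (fun y => fderiv ℝ w y
      (EuclideanSpace.single i 1)) x (EuclideanSpace.single i 1)) U := fun i =>
    ((hw1 i).contDiffOn_fderiv_apply hU (k := 0) (by norm_num) _).continuousOn
  have hs1 : ∀ i, tsupport (fun y => fderiv ℝ ψ y (EuclideanSpace.single i 1)) ⊆ tsupport ψ :=
    fun i => tsupport_fderiv_apply_subset ℝ _
  have hs2 : ∀ i, tsupport (fun x => fderiv ℝ (fun y => fderiv ℝ ψ y
      (EuclideanSpace.single i 1)) x (EuclideanSpace.single i 1)) ⊆ tsupport ψ :=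
    fun i => (tsupport_fderiv_apply_subset ℝ _).trans (hs1 i)
  have hdw : ∀ x ∈ U, DifferentiableAt ℝ w x := fun x hx =>
    (hw.contDiffAt (hU.mem_nhds hx)).differentiableAt (by norm_num)
  have hdw1 : ∀ i, ∀ x ∈ U, DifferentiableAt ℝ
      (fun y => fderiv ℝ w y (EuclideanSpace.single i 1)) x := fun i x hx =>
    ((hw1 i).contDiffAt (hU.mem_nhds hx)).differentiableAt (by norm_num)
  have i1 := fun i => hint ψ _ hψ.continuous subset_rfl (hw2 i)
  have i2 := fun i => hint _ _ (hψ1 i).continuous (hs1 i) (hw1 i).continuousOn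
  have i3 := fun i => hint _ _ (hψ2 i) (hs2 i) hw.continuousOn
  simp only [lap, Finset.mul_sum, Finset.sum_mul]
  refine ⟨integrable_finsetSum _ fun i _ => i1 i, integrable_finsetSum _ fun i _ => i3 i, ?_⟩
  rw [integral_finsetSum _ fun i _ => i1 i, integral_finsetSum _ fun i _ => i3 i]
  refine Finset.sum_congr rfl fun i _ => ?_
  rw [integral_mul_fderiv_eq_neg_fderiv_mul_of_integrable (i2 i) (i1 i)
    (hint ψ _ hψ.continuous subset_rfl (hw1 i).continuousOn)
    (fun x _ => hψ.differentiable (by norm_num) x) (fun x hx => hdw1 i x (hs hx)),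
    integral_mul_fderiv_eq_neg_fderiv_mul_of_integrable (i3 i) (i2 i)
    (hint _ _ (hψ1 i).continuous (hs1 i) hw.continuousOn)
    (fun x _ => (hψ1 i).differentiable (by norm_num) x) (fun x hx => hdw x (hs (hs1 i hx))), neg_neg]

theorem lap_mul_radial {m : ℕ} {h η : ℝ → ℝ} (hh : ContDiff ℝ 2 h) (hη : ContDiff ℝ 2 η) (c : ℝ)
    (x : EuclideanSpace ℝ (Fin (m + 1))) :
    lap (fun y : EuclideanSpace ℝ (Fin (m + 1)) => h (y (Fin.last m)) * η (c * ‖y‖ ^ 2)) x =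
      deriv (deriv h) (x (Fin.last m)) * η (c * ‖x‖ ^ 2) +
      4 * c * (x (Fin.last m) * deriv h (x (Fin.last m))) * deriv η (c * ‖x‖ ^ 2) +
      h (x (Fin.last m)) * (4 * c * (c * ‖x‖ ^ 2) * deriv (deriv η) (c * ‖x‖ ^ 2) +
        2 * c * ((m : ℝ) + 1) * deriv η (c * ‖x‖ ^ 2)) := by
  have hh' : ContDiff ℝ 1 (deriv h) := hh.deriv'
  have hη' : ContDiff ℝ 1 (deriv η) := hη.deriv'
  have dh : ∀ t, HasDerivAt h (deriv h t) t := fun t =>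
    (hh.differentiable (by norm_num) t).hasDerivAt
  have dη : ∀ t, HasDerivAt η (deriv η t) t := fun t =>
    (hη.differentiable (by norm_num) t).hasDerivAt
  have dh' : ∀ t, HasDerivAt (deriv h) (deriv (deriv h) t) t := fun t =>
    (hh'.differentiable (by norm_num) t).hasDerivAt
  have dη' : ∀ t, HasDerivAt (deriv η) (deriv (deriv η) t) t := fun t =>
    (hη'.differentiable (by norm_num) t).hasDerivAt
  have dp : ∀ (i : Fin (m + 1)) (y : EuclideanSpace ℝ (Fin (m + 1))),
      HasFDerivAt (fun y : EuclideanSpace ℝ (Fin (m + 1)) => y i)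
        (EuclideanSpace.proj i : EuclideanSpace ℝ (Fin (m + 1)) →L[ℝ] ℝ) y := fun i y =>
    (EuclideanSpace.proj i : EuclideanSpace ℝ (Fin (m + 1)) →L[ℝ] ℝ).hasFDerivAt
  have dn : ∀ y : EuclideanSpace ℝ (Fin (m + 1)),
      HasFDerivAt (fun y : EuclideanSpace ℝ (Fin (m + 1)) => c * ‖y‖ ^ 2)
        (c • (2 • innerSL ℝ y)) y := fun y => (hasStrictFDerivAt_norm_sq y).hasFDerivAt.const_mul c
  have key : ∀ (f g : ℝ → ℝ) (f' g' : ℝ) (y : EuclideanSpace ℝ (Fin (m + 1))),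
      HasDerivAt f f' (y (Fin.last m)) → HasDerivAt g g' (c * ‖y‖ ^ 2) →
      HasFDerivAt (fun y : EuclideanSpace ℝ (Fin (m + 1)) => f (y (Fin.last m)) * g (c * ‖y‖ ^ 2))
        (f (y (Fin.last m)) • g' • (c • (2 • innerSL ℝ y)) + g (c * ‖y‖ ^ 2) • f' •
          (EuclideanSpace.proj (Fin.last m) : EuclideanSpace ℝ (Fin (m + 1)) →L[ℝ] ℝ)) y :=
    fun f g f' g' y hf hg => (hf.comp_hasFDerivAt y (dp _ y)).mul (hg.comp_hasFDerivAt y (dn y))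
  set δ : Fin (m + 1) → ℝ := fun i => if i = Fin.last m then 1 else 0 with hδ
  have hproj : ∀ i, (EuclideanSpace.single i (1 : ℝ) : EuclideanSpace ℝ (Fin (m + 1))) (Fin.last m)
      = δ i := fun i => by simp [hδ, eq_comm]
  have d1 : ∀ i (y : EuclideanSpace ℝ (Fin (m + 1))),
      fderiv ℝ (fun y : EuclideanSpace ℝ (Fin (m + 1)) =>
        h (y (Fin.last m)) * η (c * ‖y‖ ^ 2)) y (EuclideanSpace.single i 1) =
      2 * c * ((h (y (Fin.last m)) * deriv η (c * ‖y‖ ^ 2)) * y i) +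
        δ i * (deriv h (y (Fin.last m)) * η (c * ‖y‖ ^ 2)) := by
    intro i y
    rw [(key h η _ _ y (dh _) (dη _)).fderiv]
    simp only [_root_.add_apply, _root_.smul_apply, smul_eq_mul, innerSL_apply_apply,
      EuclideanSpace.inner_single_right, PiLp.proj_apply, hproj]
    simp
    ring
  have d2 : ∀ i, fderiv ℝ (fun y => fderiv ℝ (fun y : EuclideanSpace ℝ (Fin (m + 1)) =>
        h (y (Fin.last m)) * η (c * ‖y‖ ^ 2)) y (EuclideanSpace.single i 1)) x
        (EuclideanSpace.single i 1) =
      δ i * δ i * (deriv (deriv h) (x (Fin.last m)) * η (c * ‖x‖ ^ 2)) +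
      4 * c * (δ i * x i) * (deriv h (x (Fin.last m)) * deriv η (c * ‖x‖ ^ 2)) +
      4 * c ^ 2 * x i ^ 2 * (h (x (Fin.last m)) * deriv (deriv η) (c * ‖x‖ ^ 2)) +
      2 * c * (h (x (Fin.last m)) * deriv η (c * ‖x‖ ^ 2)) := by
    intro i
    rw [funext (d1 i)]
    have := (((key h (deriv η) _ _ x (dh _) (dη' _)).fun_mul (dp i x)).const_mul (2 * c)).fun_add
      ((key (deriv h) η _ _ x (dh' _) (dη _)).const_mul (δ i))
    rw [this.fderiv]
    simp only [_root_.add_apply, _root_.smul_apply, smul_eq_mul, innerSL_apply_apply,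
      EuclideanSpace.inner_single_right, PiLp.proj_apply, hproj]
    simp
    ring
  simp only [lap, d2, Finset.sum_add_distrib, ← Finset.sum_mul, ← Finset.mul_sum]
  rw [EuclideanSpace.real_norm_sq_eq]
  simp [hδ]
  ring

theorem neg_lap_mul_radial_le {m : ℕ} {h η : ℝ → ℝ} (hh : ContDiff ℝ 2 h) (hη : ContDiff ℝ 2 η)
    (h0 : ∀ s, 0 ≤ h s) (h2 : ∀ s, 0 ≤ deriv (deriv h) s) (h1 : ∀ s, 0 ≤ s * deriv h s)
    (h3 : ∀ s, s * deriv h s ≤ 3 * h s) (η0 : ∀ t, 0 ≤ η t) (ηl : ∀ t ≤ 1, η t = 1)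
    (ηr : ∀ t, 2 ≤ t → η t = 0) {r C : ℝ} (hr : 0 < r) (hC : 0 ≤ C)
    (η1 : ∀ t, |deriv η t| ≤ C * η t ^ r) (η2 : ∀ t, |deriv (deriv η) t| ≤ C * η t ^ r)
    {c : ℝ} (hc : 0 < c) (x : EuclideanSpace ℝ (Fin (m + 1))) :
    -lap (fun y : EuclideanSpace ℝ (Fin (m + 1)) => h (y (Fin.last m)) * η (c * ‖y‖ ^ 2)) x ≤
      {y : EuclideanSpace ℝ (Fin (m + 1)) | 1 ≤ c * ‖y‖ ^ 2 ∧ c * ‖y‖ ^ 2 < 2}.indicator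
        (fun y => (22 + 2 * m) * C * c * h (y (Fin.last m)) * η (c * ‖y‖ ^ 2) ^ r) x := by
  rw [lap_mul_radial hh hη]
  have a0 := mul_nonneg (h2 (x (Fin.last m))) (η0 (c * ‖x‖ ^ 2))
  have b0 := h0 (x (Fin.last m))
  have b1 := h1 (x (Fin.last m))
  have b3 := h3 (x (Fin.last m))
  set s := x (Fin.last m)
  by_cases hx : x ∈ {y : EuclideanSpace ℝ (Fin (m + 1)) | 1 ≤ c * ‖y‖ ^ 2 ∧ c * ‖y‖ ^ 2 < 2}
  · rw [indicator_of_mem hx]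
    have e1 := abs_le.1 (η1 (c * ‖x‖ ^ 2))
    have e2 := abs_le.1 (η2 (c * ‖x‖ ^ 2))
    have hE : 0 ≤ C * η (c * ‖x‖ ^ 2) ^ r := mul_nonneg hC (Real.rpow_nonneg (η0 _) _)
    obtain ⟨hx1, hx2⟩ := hx
    generalize hE' : C * η (c * ‖x‖ ^ 2) ^ r = E at *
    have t1 : c * (s * deriv h s) * (-deriv η (c * ‖x‖ ^ 2)) ≤ c * (3 * h s) * E :=
      (mul_le_mul_of_nonneg_left (neg_le.1 e1.1) (mul_nonneg hc.le b1)).trans (by gcongr)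
    have t2 : c * h s * (c * ‖x‖ ^ 2) * (-deriv (deriv η) (c * ‖x‖ ^ 2)) ≤ c * h s * 2 * E :=
      (mul_le_mul_of_nonneg_left (neg_le.1 e2.1) (by positivity)).trans (by gcongr)
    have t3 : c * h s * ((m : ℝ) + 1) * (-deriv η (c * ‖x‖ ^ 2)) ≤ c * h s * ((m : ℝ) + 1) * E := by
      gcongr
      linarith [e1.1]
    calc _ ≤ (22 + 2 * m) * c * h s * E := by linarith
      _ = _ := by rw [← hE']; ring
  · rw [indicator_of_notMem hx]
    have hz : deriv η (c * ‖x‖ ^ 2) = 0 ∧ deriv (deriv η) (c * ‖x‖ ^ 2) = 0 := by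
      rcases lt_or_ge (c * ‖x‖ ^ 2) 1 with hl | hl
      · have he : η =ᶠ[nhds (c * ‖x‖ ^ 2)] fun _ => 1 := by
          filter_upwards [Iio_mem_nhds hl] with t ht using ηl t (le_of_lt ht)
        exact ⟨by simp [he.deriv_eq], by simp [he.deriv.deriv_eq]⟩
      · have hge : 2 ≤ c * ‖x‖ ^ 2 := by
          by_contra! hlt
          exact hx ⟨hl, hlt⟩
        have e1 := η1 (c * ‖x‖ ^ 2)
        have e2 := η2 (c * ‖x‖ ^ 2)
        rw [ηr _ hge, Real.zero_rpow hr.ne', mul_zero] at e1 e2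
        exact ⟨abs_nonpos_iff.1 e1, abs_nonpos_iff.1 e2⟩
    rw [hz.1, hz.2]
    linarith

/-- The shifted half-space carries no positive solution of `-Δw ≥ c w ^ q` for subcritical and
critical exponents `q`. -/
theorem not_superharmonic_half_space {m : ℕ} {q c : ℝ} (hq : 1 < q) (hqm : m * q ≤ m + 2)
    (hc : 0 < c) {w : EuclideanSpace ℝ (Fin (m + 1)) → ℝ}
    (hw : ContDiffOn ℝ 2 w {x | -1 < x (Fin.last m)})
    (hpos : ∀ x : EuclideanSpace ℝ (Fin (m + 1)), -1 < x (Fin.last m) → 0 < w x)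
    (hlap : ∀ x : EuclideanSpace ℝ (Fin (m + 1)), -1 < x (Fin.last m) →
      c * w x ^ q ≤ -lap w x) : False := by
  obtain ⟨h, hh, hz, hp, habs, h2, h1, h3⟩ := exists_convex_weight
  obtain ⟨η, C₀, hη, hC₀, η0, ηle, ηl, ηr, η1, η2⟩ := exists_cutoff hq
  have h0 : ∀ s, 0 ≤ h s := fun s => by
    rcases le_or_gt s 0 with hs | hs
    exacts [(hz s hs).ge, (hp s hs).le]
  have h2z : ∀ s < 0, deriv (deriv h) s = 0 := by
    intro s hs
    have he : h =ᶠ[nhds s] fun _ => 0 := by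
      filter_upwards [Iio_mem_nhds hs] with t ht using hz t (le_of_lt ht)
    simp [he.deriv.deriv_eq]
  have hq0 : 0 < q := by linarith
  have hconj : q.HolderConjugate (q / (q - 1)) := Real.HolderConjugate.conjExponent hq
  set q' := q / (q - 1) with hq'
  have hq'm : (m : ℝ) + 2 ≤ 2 * q' := by
    rw [hq', mul_div_assoc', le_div_iff₀ (by linarith)]
    linarith
  set U : Set (EuclideanSpace ℝ (Fin (m + 1))) := {x | -1 < x (Fin.last m)} with hU_def
  have hcoord : Continuous fun x : EuclideanSpace ℝ (Fin (m + 1)) => x (Fin.last m) := by fun_prop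
  have hU : IsOpen U := isOpen_lt continuous_const hcoord
  set H : EuclideanSpace ℝ (Fin (m + 1)) → ℝ := fun x => h (x (Fin.last m)) with hH
  have hHc : Continuous H := hh.continuous.comp hcoord
  have hHU : tsupport H ⊆ U := by
    have hcl : IsClosed {x : EuclideanSpace ℝ (Fin (m + 1)) | 0 ≤ x (Fin.last m)} :=
      isClosed_le continuous_const hcoord
    refine (closure_minimal ?_ hcl).trans fun x hx => ?_
    · intro x hx
      by_contra hneg
      exact hx (hz _ (not_le.1 hneg).le)
    · exact lt_of_lt_of_le (neg_one_lt_zero (R := ℝ)) hx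
  set G : EuclideanSpace ℝ (Fin (m + 1)) → ℝ := fun x => H x * w x ^ q with hG
  have hGc : Continuous G := continuous_mul_of_tsupport_subset hU hHc hHU
    (hw.continuousOn.rpow_const fun x hx => Or.inl (hpos x hx).ne')
  have hH0 : ∀ x, 0 ≤ H x := fun x => h0 _
  have hHz : ∀ x : EuclideanSpace ℝ (Fin (m + 1)), x (Fin.last m) ≤ 0 → H x = 0 :=
    fun x hx => hz _ hx
  have hG0 : ∀ x, 0 ≤ G x := fun x => by
    rcases le_or_gt (x (Fin.last m)) 0 with hx | hx
    · simp [hG, hHz x hx]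
    · exact mul_nonneg (hH0 x) (Real.rpow_nonneg (hpos x (by linarith)).le _)
  set J : ℝ → ℝ := fun R => ∫ x in Metric.ball 0 R, G x with hJ
  have hball : ∀ (f : EuclideanSpace ℝ (Fin (m + 1)) → ℝ) (R : ℝ), Continuous f →
      IntegrableOn f (Metric.ball 0 R) := fun f R hf =>
    (hf.continuousOn.integrableOn_compact (isCompact_closedBall 0 R)).mono_set
      Metric.ball_subset_closedBall
  have hJm : Monotone J := fun R S hRS =>
    setIntegral_mono_set (hball G S hGc) (ae_of_all _ hG0)
      (Metric.ball_subset_ball hRS).eventuallyLE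
  set A : ℝ → Set (EuclideanSpace ℝ (Fin (m + 1))) := fun R =>
    Metric.ball 0 (2 * R) \ Metric.ball 0 R with hA
  have hAm : ∀ R, MeasurableSet (A R) := fun R => measurableSet_ball.diff measurableSet_ball
  have hAi : ∀ (f : EuclideanSpace ℝ (Fin (m + 1)) → ℝ) (R : ℝ), Continuous f →
      IntegrableOn f (A R) := fun f R hf => (hball f (2 * R) hf).mono_set sdiff_subset
  set φ : ℝ → EuclideanSpace ℝ (Fin (m + 1)) → ℝ := fun R x => η ((R ^ 2)⁻¹ * ‖x‖ ^ 2) with hφ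
  have hφ0 : ∀ R x, 0 ≤ φ R x := fun R x => η0 _
  have hφ1 : ∀ R x, φ R x ≤ 1 := fun R x => ηle _
  have hφd : ∀ R, ContDiff ℝ 2 (φ R) := fun R =>
    hη.comp (contDiff_const.mul (contDiff_norm_sq ℝ))
  have hφc : ∀ R, Continuous (φ R) := fun R => (hφd R).continuous
  have hφs : ∀ R, 0 < R → HasCompactSupport (φ R) := by
    intro R hR
    refine HasCompactSupport.of_support_subset_isCompact (isCompact_closedBall 0 (2 * R)) ?_
    intro x hx
    rw [mem_closedBall_zero_iff]
    by_contra! hlt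
    refine hx (ηr _ ?_)
    rw [inv_mul_eq_div, le_div_iff₀ (by positivity)]
    nlinarith
  have hGφ : ∀ R, 0 < R → Integrable fun x => G x * φ R x := fun R hR =>
    (hGc.mul (hφc R)).integrable_of_hasCompactSupport (hφs R hR).mul_left
  set I : ℝ → ℝ := fun R => ∫ x, G x * φ R x with hI
  set V : ℝ := volume.real (Metric.ball (0 : EuclideanSpace ℝ (Fin (m + 1))) 1) with hV
  set B : ℝ := (22 + 2 * m) * C₀ + 1 with hB
  have hB0 : 0 < B := by positivity
  have main : ∀ α β : ℝ, 0 ≤ α → 0 ≤ β →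
      (∀ a b : ℝ, 0 ≤ a → 0 ≤ b → a * b ≤ α * a ^ q + β * b ^ q') → ∀ R, 1 ≤ R →
      c * I R ≤ B * (α * (∫ x in A R, G x * φ R x) + β * (2 ^ (m + 2) * V)) := by
    intro α β hα hβ hY R hR
    have hR0 : 0 < R := by linarith
    have hψd : ContDiff ℝ 2 (fun x => H x * φ R x) := by
      refine ContDiff.mul (hh.comp ?_) (hφd R)
      fun_prop
    obtain ⟨i1, i2, e⟩ := integral_mul_lap_eq hU hw hψd (hφs R hR0).mul_left
      ((tsupport_mul_subset_left).trans hHU)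
    have hpow : ((R ^ 2)⁻¹ : ℝ) ^ q' ≤ (R ^ (m + 2))⁻¹ := by
      rw [Real.inv_rpow (by positivity), ← Real.rpow_natCast R 2, ← Real.rpow_mul hR0.le,
        ← Real.rpow_natCast]
      refine inv_anti₀ (by positivity) (Real.rpow_le_rpow_of_exponent_le hR ?_)
      push_cast
      exact hq'm
    have hlow : c * I R ≤ ∫ x, -(H x * φ R x * lap w x) := by
      rw [hI, ← integral_const_mul]
      refine integral_mono ((hGφ R hR0).const_mul c) i1.neg fun x => ?_
      rcases le_or_gt (x (Fin.last m)) 0 with hx | hx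
      · simp [hG, hHz x hx]
      · have := mul_le_mul_of_nonneg_left (hlap x (by linarith))
          (mul_nonneg (hH0 x) (hφ0 R x))
        simp only [hG]
        linarith
    have hup : ∫ x, -(lap (fun x => H x * φ R x) x * w x) ≤
        ∫ x in A R, B * (α * (G x * φ R x) + β * (R ^ (m + 2))⁻¹ * H x) := by
      rw [← integral_indicator (hAm R)]
      refine integral_mono i2.neg ((hAi _ R (by fun_prop)).integrable_indicator (hAm R)) fun x => ?_
      have hnn : ∀ y, 0 ≤ B * (α * (G y * φ R y) + β * (R ^ (m + 2))⁻¹ * H y) := by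
        intro y
        have := hG0 y
        have := hH0 y
        have := hφ0 R y
        positivity
      rcases le_or_gt (x (Fin.last m)) (-1) with hx | hx
      · have hlz : lap (fun x => H x * φ R x) x = 0 := by
          rw [hH, hφ, lap_mul_radial hh hη]
          have hs : x (Fin.last m) * deriv h (x (Fin.last m)) = 0 := by
            refine le_antisymm ((h3 _).trans ?_) (h1 _)
            rw [hz _ (by linarith), mul_zero]
          rw [h2z _ (by linarith), hz _ (by linarith), hs]
          ring
        simp only [hlz, zero_mul, neg_zero]
        exact indicator_nonneg (fun y _ => hnn y) x
      · have hwx := hpos x hx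
        have hle := neg_lap_mul_radial_le hh hη h0 h2 h1 h3 η0 ηl ηr (r := 1 / q) (by positivity)
          hC₀ η1 η2 (c := (R ^ 2)⁻¹) (by positivity) x
        rw [← neg_mul]
        refine (mul_le_mul_of_nonneg_right hle hwx.le).trans ?_
        by_cases hxA : x ∈ {y : EuclideanSpace ℝ (Fin (m + 1)) |
            1 ≤ (R ^ 2)⁻¹ * ‖y‖ ^ 2 ∧ (R ^ 2)⁻¹ * ‖y‖ ^ 2 < 2}
        · have hxA' : x ∈ A R := by
            obtain ⟨hx1, hx2⟩ := hxA
            rw [inv_mul_eq_div, le_div_iff₀ (by positivity)] at hx1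
            rw [inv_mul_eq_div, div_lt_iff₀ (by positivity)] at hx2
            refine ⟨?_, ?_⟩
            · rw [mem_ball_zero_iff]
              nlinarith [norm_nonneg x]
            · rw [mem_ball_zero_iff, not_lt]
              nlinarith [norm_nonneg x]
          rw [indicator_of_mem hxA, indicator_of_mem hxA']
          have hφx := hφ0 R x
          have hHx := hH0 x
          have y1 := hY (w x * φ R x ^ (1 / q)) (R ^ 2)⁻¹ (by positivity) (by positivity)
          rw [Real.mul_rpow hwx.le (by positivity), ← Real.rpow_mul hφx, one_div,
            inv_mul_cancel₀ hq0.ne', Real.rpow_one] at y1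
          have y2 : w x * φ R x ^ q⁻¹ * (R ^ 2)⁻¹ ≤
              α * (w x ^ q * φ R x) + β * (R ^ (m + 2))⁻¹ := by
            refine y1.trans ?_
            gcongr
          have hBle : (22 + 2 * (m : ℝ)) * C₀ ≤ B := by simp [hB]
          calc _ = (22 + 2 * (m : ℝ)) * C₀ * (H x * (w x * φ R x ^ q⁻¹ * (R ^ 2)⁻¹)) := by
                simp only [hH, hφ, one_div]
                ring
            _ ≤ B * (H x * (α * (w x ^ q * φ R x) + β * (R ^ (m + 2))⁻¹)) := by
                gcongr
            _ = _ := by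
                simp only [hG]
                ring
        · rw [indicator_of_notMem hxA, zero_mul]
          exact indicator_nonneg (fun y _ => hnn y) x
    have hHint : ∫ x in A R, H x ≤ 2 ^ (m + 2) * V * R ^ (m + 2) := by
      have hfin : volume (Metric.ball (0 : EuclideanSpace ℝ (Fin (m + 1))) (2 * R)) ≠ ⊤ :=
        measure_ball_lt_top.ne
      calc ∫ x in A R, H x ≤ ∫ x in Metric.ball 0 (2 * R), H x :=
            setIntegral_mono_set (hball H _ hHc) (ae_of_all _ hH0) sdiff_subset.eventuallyLE
        _ ≤ ∫ x in Metric.ball (0 : EuclideanSpace ℝ (Fin (m + 1))) (2 * R), 2 * R := by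
            refine setIntegral_mono_on (hball H _ hHc) (integrableOn_const hfin)
              measurableSet_ball fun x hx => ?_
            rw [mem_ball_zero_iff] at hx
            exact ((habs _).trans (by simpa using PiLp.norm_apply_le x (Fin.last m))).trans hx.le
        _ = 2 ^ (m + 2) * V * R ^ (m + 2) := by
            rw [setIntegral_const, measureReal_def, Measure.addHaar_ball_of_pos _ _ (by positivity),
              ENNReal.toReal_mul, ENNReal.toReal_ofReal (by positivity), ← measureReal_def, ← hV,
              finrank_euclideanSpace_fin, smul_eq_mul]
            ring
    rw [integral_neg, e, ← integral_neg] at hlow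
    refine hlow.trans (hup.trans ?_)
    rw [integral_const_mul, integral_add ((hAi _ R (by fun_prop)).const_mul α)
      ((hAi _ R hHc).const_mul _), integral_const_mul, integral_const_mul]
    gcongr B * (_ + ?_)
    calc β * (R ^ (m + 2))⁻¹ * ∫ x in A R, H x
        ≤ β * (R ^ (m + 2))⁻¹ * (2 ^ (m + 2) * V * R ^ (m + 2)) := by gcongr
      _ = β * (2 ^ (m + 2) * V) := by field_simp
  have hJI : ∀ R, 1 ≤ R → J R ≤ I R := by
    intro R hR
    have hR0 : 0 < R := by linarith
    have heq : J R = ∫ x in Metric.ball 0 R, G x * φ R x := by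
      refine setIntegral_congr_fun measurableSet_ball fun x hx => ?_
      rw [mem_ball_zero_iff] at hx
      have : φ R x = 1 := by
        refine ηl _ ?_
        rw [inv_mul_eq_div, div_le_one (by positivity)]
        nlinarith [norm_nonneg x]
      simp [this]
    rw [heq]
    exact setIntegral_le_integral (hGφ R hR0) (ae_of_all _ fun x => mul_nonneg (hG0 x) (hφ0 R x))
  have hAI : ∀ R, 1 ≤ R → ∫ x in A R, G x * φ R x ≤ I R := fun R hR =>
    setIntegral_le_integral (hGφ R (by linarith))
      (ae_of_all _ fun x => mul_nonneg (hG0 x) (hφ0 R x))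
  have hAJ : ∀ R, 1 ≤ R → ∫ x in A R, G x * φ R x ≤ J (2 * R) - J R := by
    intro R hR
    rw [hJ]
    dsimp only
    rw [← setIntegral_sdiff measurableSet_ball (hball G _ hGc)
      (Metric.ball_subset_ball (by linarith))]
    exact setIntegral_mono_on (hAi _ R (by fun_prop)) (hAi _ R hGc) (hAm R) fun x _ =>
      mul_le_of_le_one_right (hG0 x) (hφ1 R x)
  have hV0 : 0 ≤ V := measureReal_nonneg
  have hJ1 : J 1 ≤ 0 := by
    have hroot : ∀ ε r : ℝ, 0 < ε → 0 < r → ∃ t : ℝ, 0 < t ∧ t ^ r = ε := fun ε r hε hr =>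
      ⟨ε ^ r⁻¹, by positivity, Real.rpow_inv_rpow hε.le hr.ne'⟩
    obtain ⟨t, ht, htq⟩ := hroot (c / (2 * B)) q (by positivity) hq0
    refine nonpos_of_doubling hJm (M := 2 / c * (B * (t⁻¹ ^ q' * (2 ^ (m + 2) * V))))
      (fun R hR => ?_) fun δ hδ => ?_
    · have hm := main (t ^ q) (t⁻¹ ^ q') (by positivity) (by positivity)
        (fun a b ha hb => le_add_rpow_of_holderConjugate hconj ha hb ht) R hR
      refine (hJI R hR).trans ?_
      rw [htq] at hm
      have h4 : B * (c / (2 * B) * ∫ x in A R, G x * φ R x) ≤ c / 2 * I R := by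
        calc _ = c / 2 * ∫ x in A R, G x * φ R x := by field_simp
          _ ≤ _ := by gcongr; exact hAI R hR
      rw [div_mul_eq_mul_div, le_div_iff₀ hc]
      linarith
    · obtain ⟨s, hs, hsq⟩ := hroot (c * δ / (B * (2 ^ (m + 2) * V + 1))) q' (by positivity)
        hconj.symm.pos
      refine ⟨B * s⁻¹ ^ q / c, fun R hR => ?_⟩
      have hm := main (s⁻¹ ^ q) (s ^ q') (by positivity) (by positivity)
        (fun a b ha hb => by
          simpa using le_add_rpow_of_holderConjugate hconj ha hb (inv_pos.2 hs)) R hR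
      refine (hJI R hR).trans ?_
      rw [hsq] at hm
      have h4 : B * (c * δ / (B * (2 ^ (m + 2) * V + 1)) * (2 ^ (m + 2) * V)) ≤ c * δ := by
        calc _ = c * δ * (2 ^ (m + 2) * V / (2 ^ (m + 2) * V + 1)) := by field_simp
          _ ≤ _ := mul_le_of_le_one_right (by positivity)
            ((div_le_one (by positivity)).2 (by linarith))
      have h5 : B * (s⁻¹ ^ q * ∫ x in A R, G x * φ R x) ≤ B * (s⁻¹ ^ q * (J (2 * R) - J R)) := by
        gcongr
        exact hAJ R hR
      rw [← mul_le_mul_iff_right₀ hc]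
      calc c * I R ≤ B * (s⁻¹ ^ q * (J (2 * R) - J R)) + c * δ := by linarith
        _ = _ := by field_simp
  refine hJ1.not_gt ?_
  rw [hJ]
  refine (setIntegral_pos_iff_support_of_nonneg_ae (ae_of_all _ hG0) (hball G 1 hGc)).2 ?_
  refine (hGc.isOpen_support.inter Metric.isOpen_ball).measure_pos _
    ⟨EuclideanSpace.single (Fin.last m) (1 / 2), ?_, ?_⟩
  · have hx : 0 < (EuclideanSpace.single (Fin.last m) (1 / 2 : ℝ) :
        EuclideanSpace ℝ (Fin (m + 1))) (Fin.last m) := by simp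
    exact (mul_pos (hp _ hx) (Real.rpow_pos_of_pos (hpos _ (by linarith)) _)).ne'
  · rw [mem_ball_zero_iff, PiLp.norm_single]
    norm_num

theorem liouville_supersolution_half_space
    {m : ℕ} (hN : 3 ≤ m + 1) {p σ : ℝ} (hp : 1 < p)
    (hσ : σ ≤ (((m : ℝ) + 1) + 1 - (((m : ℝ) + 1) - 1) * p) / 2) :
    ¬ ∃ u : EuclideanSpace ℝ (Fin (m + 1)) → ℝ,
      ContinuousOn u {x | 0 ≤ x (Fin.last m)} ∧
      (∀ x : EuclideanSpace ℝ (Fin (m + 1)), x (Fin.last m) = 0 → u x = 0) ∧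
      ContDiffOn ℝ 2 u {x | 0 < x (Fin.last m)} ∧
      (∀ x : EuclideanSpace ℝ (Fin (m + 1)), 0 < x (Fin.last m) → 0 < u x) ∧
      (∀ x : EuclideanSpace ℝ (Fin (m + 1)), 0 < x (Fin.last m) →
        u x ^ p ≤ -lap u x + σ * ‖gradient u x‖ ^ 2 / u x) := by
  rintro ⟨u, -, -, hu, hpos, hsup⟩
  have hm : (2 : ℝ) ≤ m := by exact_mod_cast (by omega : 2 ≤ m)
  have hσ1 : 0 < 1 - σ := by nlinarith
  set U : Set (EuclideanSpace ℝ (Fin (m + 1))) := {x | 0 < x (Fin.last m)} with hU_def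
  have hU : IsOpen U := isOpen_lt continuous_const (by fun_prop)
  set e : EuclideanSpace ℝ (Fin (m + 1)) := EuclideanSpace.single (Fin.last m) 1 with he
  have hmem : ∀ x : EuclideanSpace ℝ (Fin (m + 1)), -1 < x (Fin.last m) → x + e ∈ U := by
    intro x hx
    simp [hU_def, he]
    linarith
  refine not_superharmonic_half_space (m := m) (q := (p - σ) / (1 - σ)) (c := 1 - σ)
    (w := fun x => u (x + e) ^ (1 - σ)) ?_ ?_ hσ1 ?_ ?_ ?_
  · rw [lt_div_iff₀ hσ1]
    linarith
  · rw [mul_div_assoc', div_le_iff₀ hσ1]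
    linarith
  · have h1 : ContDiffOn ℝ 2 (fun x => u x ^ (1 - σ)) U :=
      hu.rpow_const_of_ne fun x hx => (hpos x hx).ne'
    exact h1.comp (contDiff_id.add contDiff_const).contDiffOn hmem
  · exact fun x hx => Real.rpow_pos_of_pos (hpos _ (hmem x hx)) _
  · intro x hx
    have hux := hpos _ (hmem x hx)
    rw [lap_comp_add_right (fun y => u y ^ (1 - σ)), lap_rpow hU hu hpos _ (hmem x hx),
      ← Real.rpow_mul hux.le, mul_div_cancel₀ _ hσ1.ne']
    have h1 := mul_le_mul_of_nonneg_left (hsup _ (hmem x hx))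
      (Real.rpow_nonneg hux.le (-σ))
    rw [← Real.rpow_add hux, show -σ + p = p - σ by ring] at h1
    have h2 := mul_le_mul_of_nonneg_left h1 hσ1.le
    refine h2.trans (le_of_eq ?_)
    rw [show (1 - σ - 1 : ℝ) = -σ by ring]
    ring
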